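/- Contraction properties of the rescaled Ornstein–Uhlenbeck-type semigroup in Gaussian-weighted Lᵐ spaces: (a) for every 1 ≤ m < ∞, every δ > 0, every σ ≥ 0 and every bounded continuous φ : ℝ → ℝ, one has ‖T_δ(σ)φ‖_{L^m_{K_δ}} ≤ ‖φ‖_{L^m_{K_δ}}; (b) moreover, for all 0 < δ ≤ λ < ∞, ‖T_δ(σ)φ‖_{L^m_{K_λ}} ≤ (λ/δ)^{1/2} ‖φ‖_{L^m_{K_λ}} for all σ ≥ 0. -/

import Mathlib

open Set Filter MeasureTheory

/-- The Gaussian weight `K_δ(θ) = (4πδ)^{-1/2} e^{-θ²/(4δ)}`. -/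
noncomputable def gaussWeight (d θ : ℝ) : ℝ :=
  (4 * Real.pi * d) ^ (-(1 / 2 : ℝ)) * Real.exp (-θ ^ 2 / (4 * d))

/-- The weighted norm `‖φ‖_{L^m_{K_d}} = (∫ |φ(θ)|^m K_d(θ) dθ)^{1/m}`. -/
noncomputable def gaussNorm (m d : ℝ) (φ : ℝ → ℝ) : ℝ :=
  (∫ θ : ℝ, |φ θ| ^ m * gaussWeight d θ) ^ (1 / m)


lemma aux_second_deriv {f f1 : ℝ → ℝ} {x c : ℝ} (h1 : ∀ y, HasDerivAt f (f1 y) y)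
    (h2 : HasDerivAt f1 c x) (hmax : IsLocalMax f x) : c ≤ 0 := by
  by_contra hc
  push Not at hc
  have hd : deriv f = f1 := funext fun y => (h1 y).deriv
  have hmin : IsLocalMin f x := by
    apply isLocalMin_of_deriv_deriv_pos
    · rw [hd, h2.deriv]; exact hc
    · exact hmax.deriv_eq_zero
    · exact (h1 x).continuousAt
  have hcst : f =ᶠ[nhds x] fun _ => f x := by
    filter_upwards [hmax, hmin] with y hy1 hy2
    exact le_antisymm hy1 hy2
  have h3 : deriv f =ᶠ[nhds x] deriv (fun _ => f x) := hcst.deriv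
  have h4 := h3.deriv_eq
  rw [hd, h2.deriv] at h4
  simp at h4
  linarith

lemma aux_time_deriv {g : ℝ → ℝ} {s c : ℝ} (hs : 0 < s) (h : HasDerivAt g c s)
    (hmax : ∀ r, 0 ≤ r → r ≤ s → g r ≤ g s) : 0 ≤ c := by
  have h1 : HasDerivWithinAt g c (Iio s) s := h.hasDerivWithinAt
  rw [hasDerivWithinAt_iff_tendsto_slope' (by simp)] at h1
  refine ge_of_tendsto h1 ?_
  have : Ioo 0 s ∈ nhdsWithin s (Iio s) := Ioo_mem_nhdsLT hs
  filter_upwards [this] with r hr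
  rw [slope_def_field]
  apply div_nonneg_of_nonpos
  · linarith [hmax r hr.1.le hr.2.le]
  · linarith [hr.2]

lemma aux_maxprin (δ : ℝ) (hδ : 0 < δ) (D Dt D1 D2 : ℝ → ℝ → ℝ) (M : ℝ)
    (hc : ContinuousOn (Function.uncurry D) (Ici (0:ℝ) ×ˢ (univ : Set ℝ)))
    (hb : ∀ s, 0 ≤ s → ∀ x, D s x ≤ M) (h0 : ∀ x, D 0 x ≤ 0)
    (ht : ∀ s, 0 < s → ∀ x, HasDerivAt (fun r => D r x) (Dt s x) s)
    (h1 : ∀ s, 0 < s → ∀ x, HasDerivAt (D s) (D1 s x) x)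
    (h2 : ∀ s, 0 < s → ∀ x, HasDerivAt (D1 s) (D2 s x) x)
    (pde : ∀ s, 0 < s → ∀ x, Dt s x = δ * D2 s x - x / 2 * D1 s x) :
    ∀ s, 0 ≤ s → ∀ x, D s x ≤ 0 := by
  intro T hT x0
  by_contra hpos
  push Not at hpos
  set V0 : ℝ := x0 ^ 2 + (2 * δ + 1) * T with hV0
  have hV0n : 0 ≤ V0 := by positivity
  set ε : ℝ := D T x0 / (2 * (V0 + 1)) with hε
  have hεp : 0 < ε := by positivity
  have hεV : ε * V0 < D T x0 := by
    rw [hε, div_mul_eq_mul_div, div_lt_iff₀ (by positivity)]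
    nlinarith
  set R : ℝ := |x0| + |M| / ε + 1 with hR
  have hR1 : 1 ≤ R := by rw [hR]; have : 0 ≤ |x0| + |M| / ε := by positivity
                         linarith
  have hRM : M < ε * R ^ 2 := by
    have h3 : ε * R = ε * |x0| + |M| + ε := by rw [hR]; field_simp
    have h4 : M < ε * R := by
      have := le_abs_self M
      have : 0 ≤ ε * |x0| := by positivity
      linarith
    nlinarith [mul_pos hεp (by linarith : 0 < R)]
  have hx0R : |x0| ≤ R := by
    rw [hR]; have : 0 ≤ |M| / ε := by positivity
    linarith
  set E : ℝ × ℝ → ℝ := fun p => D p.1 p.2 - ε * (p.2 ^ 2 + (2 * δ + 1) * p.1) with hE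
  have hcomp : IsCompact (Icc (0:ℝ) T ×ˢ Icc (-R) R) := isCompact_Icc.prod isCompact_Icc
  have hEc : ContinuousOn E (Icc (0:ℝ) T ×ˢ Icc (-R) R) := by
    apply ContinuousOn.sub
    · exact hc.mono (fun p hp => ⟨hp.1.1, mem_univ _⟩)
    · fun_prop
  have hmem : ((T, x0) : ℝ × ℝ) ∈ Icc (0:ℝ) T ×ˢ Icc (-R) R :=
    ⟨⟨hT, le_rfl⟩, abs_le.1 hx0R⟩
  obtain ⟨⟨s, x⟩, hsx, hmax⟩ := hcomp.exists_isMaxOn ⟨_, hmem⟩ hEc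
  have hEpos : 0 < E (s, x) := lt_of_lt_of_le (by simp only [hE]; linarith) (hmax hmem)
  simp only [hE] at hEpos
  obtain ⟨⟨hs0, hsT⟩, hxl, hxr⟩ := hsx
  simp only at hs0 hsT hxl hxr
  have hs : 0 < s := by
    rcases hs0.eq_or_lt with h | h
    · subst h
      have := h0 x
      have : 0 ≤ ε * (x ^ 2 + (2 * δ + 1) * 0) := by positivity
      linarith
    · exact h
  have hxM : ε * x ^ 2 < ε * R ^ 2 := by
    have := hb s hs0 x
    have : 0 ≤ ε * ((2 * δ + 1) * s) := by positivity
    nlinarith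
  have hxR : |x| < R := by
    have : x ^ 2 < R ^ 2 := lt_of_mul_lt_mul_left hxM hεp.le
    exact abs_lt_of_sq_lt_sq this (by linarith)
  obtain ⟨hxl', hxr'⟩ := abs_lt.1 hxR
  have a1 : HasDerivAt (fun r => D r x - ε * (x ^ 2 + (2 * δ + 1) * r))
      (Dt s x - ε * (2 * δ + 1)) s := by
    have := (((hasDerivAt_id s).const_mul (2 * δ + 1)).const_add (x ^ 2)).const_mul ε
    simpa using! (ht s hs x).sub this
  have b1 : 0 ≤ Dt s x - ε * (2 * δ + 1) := by
    refine aux_time_deriv hs a1 (fun r hr0 hr => ?_)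
    exact hmax (show ((r, x) : ℝ × ℝ) ∈ _ from ⟨⟨hr0, hr.trans hsT⟩, hxl, hxr⟩)
  have a2 : ∀ y, HasDerivAt (fun y => D s y - ε * (y ^ 2 + (2 * δ + 1) * s))
      (D1 s y - ε * (2 * y)) y := by
    intro y
    have := (((hasDerivAt_id y).pow 2).add_const ((2 * δ + 1) * s)).const_mul ε
    simpa using! (h1 s hs y).sub this
  have a3 : HasDerivAt (fun y => D1 s y - ε * (2 * y)) (D2 s x - ε * 2) x := by
    have := ((hasDerivAt_id x).const_mul 2).const_mul ε
    simpa using! (h2 s hs x).sub this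
  have hloc : IsLocalMax (fun y => D s y - ε * (y ^ 2 + (2 * δ + 1) * s)) x := by
    filter_upwards [Ioo_mem_nhds hxl' hxr'] with y hy
    exact hmax (show ((s, y) : ℝ × ℝ) ∈ _ from ⟨⟨hs0, hsT⟩, hy.1.le, hy.2.le⟩)
  have b2 := aux_second_deriv a2 a3 hloc
  have b3 : D1 s x - ε * (2 * x) = 0 := hloc.hasDerivAt_eq_zero (a2 x)
  have b4 := pde s hs x
  have b5 : D1 s x = ε * (2 * x) := by linarith
  rw [b5] at b4
  have : δ * (D2 s x - ε * 2) ≤ 0 := mul_nonpos_of_nonneg_of_nonpos hδ.le b2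
  have : 0 ≤ ε * x ^ 2 := by positivity
  nlinarith

lemma aux_qbound {a b c s0 X A B C x s y : ℝ} (hs0 : 0 < s0) (hA : |A| ≤ a) (hB : |B| ≤ b)
    (hC : |C| ≤ c) (hx : |x| ≤ X) (hs1 : 0 < s) (hs2 : s ≤ 2 * s0) :
    |(A + B * (x - y) + C * (x - y) ^ 2) * Real.exp (-(x - y) ^ 2 / (4 * s))|
      ≤ ((a + b) + (b + c) * (16 * s0)) * Real.exp (X ^ 2 / (16 * s0))
        * Real.exp (-(1 / (32 * s0)) * y ^ 2) := by
  set u := x - y with hu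
  have ha : 0 ≤ a := (abs_nonneg _).trans hA
  have hb : 0 ≤ b := (abs_nonneg _).trans hB
  have hc : 0 ≤ c := (abs_nonneg _).trans hC
  have p1 : |A + B * u + C * u ^ 2| ≤ (a + b) + (b + c) * u ^ 2 := by
    have t1 : |A + B * u + C * u ^ 2| ≤ |A| + |B| * |u| + |C| * u ^ 2 := by
      calc _ ≤ |A + B * u| + |C * u ^ 2| := abs_add_le _ _
        _ ≤ |A| + |B * u| + |C * u ^ 2| := by gcongr; exact abs_add_le _ _
        _ = _ := by rw [abs_mul, abs_mul, abs_of_nonneg (sq_nonneg u)]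
    have t2 : |u| ≤ 1 + u ^ 2 := by
      have := sq_abs u
      nlinarith [sq_nonneg (|u| - 1), abs_nonneg u]
    have t3 : |A| + |B| * |u| + |C| * u ^ 2 ≤ a + b * (1 + u ^ 2) + c * u ^ 2 := by
      gcongr
    linarith
  set e := Real.exp (-u ^ 2 / (16 * s0)) with he
  have hdiv : u ^ 2 / (16 * s0) ≤ u ^ 2 / (8 * s) := by
    apply div_le_div_of_nonneg_left (sq_nonneg u) (by positivity) (by linarith)
  have p2 : Real.exp (-u ^ 2 / (4 * s)) ≤ Real.exp (-u ^ 2 / (8 * s)) := by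
    apply Real.exp_le_exp.2
    rw [neg_div, neg_div, neg_le_neg_iff]
    apply div_le_div_of_nonneg_left (sq_nonneg u) (by positivity) (by linarith)
  have p3 : Real.exp (-u ^ 2 / (8 * s)) ≤ e := by
    apply Real.exp_le_exp.2
    rw [neg_div, neg_div, neg_le_neg_iff]; exact hdiv
  have p4 : u ^ 2 * Real.exp (-u ^ 2 / (4 * s)) ≤ 16 * s0 * e := by
    have e1 : Real.exp (-u ^ 2 / (4 * s))
        = Real.exp (-(u ^ 2 / (8 * s))) * Real.exp (-u ^ 2 / (8 * s)) := by
      rw [← Real.exp_add]; congr 1; field_simp; ring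
    have e2 : u ^ 2 / (8 * s) * Real.exp (-(u ^ 2 / (8 * s))) ≤ 1 := by
      rw [Real.exp_neg, ← div_eq_mul_inv, div_le_one (Real.exp_pos _)]
      linarith [Real.add_one_le_exp (u ^ 2 / (8 * s))]
    have e3 : u ^ 2 * Real.exp (-(u ^ 2 / (8 * s))) ≤ 8 * s := by
      have : u ^ 2 * Real.exp (-(u ^ 2 / (8 * s)))
        = 8 * s * (u ^ 2 / (8 * s) * Real.exp (-(u ^ 2 / (8 * s)))) := by field_simp
      rw [this]; nlinarith
    rw [e1, ← mul_assoc]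
    apply mul_le_mul (by linarith) p3 (Real.exp_pos _).le (by positivity)
  have p5 : e ≤ Real.exp (X ^ 2 / (16 * s0)) * Real.exp (-(1 / (32 * s0)) * y ^ 2) := by
    rw [he, ← Real.exp_add]
    apply Real.exp_le_exp.2
    have hX : x ^ 2 ≤ X ^ 2 := by
      rw [← sq_abs x]; gcongr
    have : y ^ 2 / 2 - X ^ 2 ≤ u ^ 2 := by
      rw [hu]; nlinarith [sq_nonneg (2 * x - y)]
    have e1 : X ^ 2 / (16 * s0) + -(1 / (32 * s0)) * y ^ 2 = -(y ^ 2 / 2 - X ^ 2) / (16 * s0) := by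
      field_simp; ring
    rw [e1]
    gcongr
  rw [abs_mul, abs_of_pos (Real.exp_pos _)]
  calc _ ≤ ((a + b) + (b + c) * u ^ 2) * Real.exp (-u ^ 2 / (4 * s)) := by gcongr
    _ = (a + b) * Real.exp (-u ^ 2 / (4 * s))
        + (b + c) * (u ^ 2 * Real.exp (-u ^ 2 / (4 * s))) := by ring
    _ ≤ (a + b) * e + (b + c) * (16 * s0 * e) := by
        gcongr; exact p2.trans p3
    _ = ((a + b) + (b + c) * (16 * s0)) * e := by ring
    _ ≤ ((a + b) + (b + c) * (16 * s0)) *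
        (Real.exp (X ^ 2 / (16 * s0)) * Real.exp (-(1 / (32 * s0)) * y ^ 2)) := by gcongr
    _ = _ := by ring

lemma aux_qint {φ : ℝ → ℝ} (hφc : Continuous φ) {Bd : ℝ} (hφb : ∀ y, |φ y| ≤ Bd)
    (A B C x s : ℝ) (hs : 0 < s) :
    Integrable (fun y => φ y *
      ((A + B * (x - y) + C * (x - y) ^ 2) * Real.exp (-(x - y) ^ 2 / (4 * s)))) := by
  have hg : Integrable (fun y : ℝ => Bd * (((|A| + |B|) + (|B| + |C|) * (16 * s))
      * Real.exp (|x| ^ 2 / (16 * s)) * Real.exp (-(1 / (32 * s)) * y ^ 2))) :=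
    ((integrable_exp_neg_mul_sq (by positivity)).const_mul _).const_mul _
  refine hg.mono' (by fun_prop) (Eventually.of_forall fun y => ?_)
  rw [norm_mul]
  have hBd : 0 ≤ Bd := (abs_nonneg _).trans (hφb 0)
  exact mul_le_mul (hφb y)
    (aux_qbound hs le_rfl le_rfl le_rfl le_rfl hs (by linarith)) (abs_nonneg _) hBd

lemma aux_dom {φ : ℝ → ℝ} (hφc : Continuous φ) {Bd : ℝ} (hφb : ∀ y, |φ y| ≤ Bd)
    (F : ℝ → ℝ → ℝ) (A B C x s : ℝ → ℝ) (t0 : ℝ)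
    (hA : ContinuousAt A t0) (hB : ContinuousAt B t0) (hC : ContinuousAt C t0)
    (hx : ContinuousAt x t0) (hs : ContinuousAt s t0) (hs0 : 0 < s t0)
    (hF : ∀ t, Continuous (F t)) (hFi : Integrable (fun y => φ y * F t0 y))
    (hd : ∀ᶠ t in nhds t0, ∀ y, HasDerivAt (fun r => F r y)
      ((A t + B t * (x t - y) + C t * (x t - y) ^ 2) * Real.exp (-(x t - y) ^ 2 / (4 * s t))) t) :
    HasDerivAt (fun t => ∫ y, φ y * F t y)
      (∫ y, φ y * ((A t0 + B t0 * (x t0 - y) + C t0 * (x t0 - y) ^ 2)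
        * Real.exp (-(x t0 - y) ^ 2 / (4 * s t0)))) t0 := by
  have hBd : 0 ≤ Bd := (abs_nonneg _).trans (hφb 0)
  have n1 : ∀ f : ℝ → ℝ, ContinuousAt f t0 → ∀ᶠ t in nhds t0, |f t| ≤ |f t0| + 1 := by
    intro f hf
    have : ∀ᶠ t in nhds t0, |f t| < |f t0| + 1 :=
      hf.abs.eventually_lt continuousAt_const (by linarith)
    exact this.mono fun t ht => ht.le
  have n2 : ∀ᶠ t in nhds t0, 0 < s t := continuousAt_const.eventually_lt hs hs0
  have n3 : ∀ᶠ t in nhds t0, s t < 2 * s t0 :=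
    hs.eventually_lt continuousAt_const (by linarith)
  have hS := (((n1 A hA).and (n1 B hB)).and ((n1 C hC).and (n1 x hx))).and ((n2.and n3).and hd)
  have hg : Integrable (fun y : ℝ => Bd * ((((|A t0| + 1) + (|B t0| + 1))
      + ((|B t0| + 1) + (|C t0| + 1)) * (16 * s t0))
      * Real.exp ((|x t0| + 1) ^ 2 / (16 * s t0)) * Real.exp (-(1 / (32 * s t0)) * y ^ 2))) :=
    ((integrable_exp_neg_mul_sq (by positivity)).const_mul _).const_mul _
  refine (hasDerivAt_integral_of_dominated_loc_of_deriv_le (F := fun t y => φ y * F t y)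
    (F' := fun t y => φ y * ((A t + B t * (x t - y) + C t * (x t - y) ^ 2)
        * Real.exp (-(x t - y) ^ 2 / (4 * s t))))
    hS (Eventually.of_forall fun t => ?_) hFi ?_ ?_ hg ?_).2
  · exact (hφc.mul (hF t)).aestronglyMeasurable
  · exact (by fun_prop : Continuous _).aestronglyMeasurable
  · refine Eventually.of_forall fun y t ht => ?_
    obtain ⟨⟨⟨q1, q2⟩, q3, q4⟩, ⟨q5, q6⟩, q7⟩ := ht
    rw [norm_mul]
    exact mul_le_mul (hφb y) (aux_qbound hs0 q1 q2 q3 q4 q5 q6.le) (abs_nonneg _) hBd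
  · refine Eventually.of_forall fun y t ht => ?_
    exact (ht.2.2 y).const_mul _

noncomputable def auxH (φ : ℝ → ℝ) (s x : ℝ) : ℝ :=
  ∫ y, φ y * ((√s)⁻¹ * Real.exp (-(x - y) ^ 2 / (4 * s)))

lemma aux_kder {s x : ℝ → ℝ} {s' x' t : ℝ} (y : ℝ) (hs : HasDerivAt s s' t)
    (hx : HasDerivAt x x' t) (hp : 0 < s t) :
    HasDerivAt (fun r => (√(s r))⁻¹ * Real.exp (-(x r - y) ^ 2 / (4 * s r)))
      (((√(s t))⁻¹ * (-s' / (2 * s t)) + (√(s t))⁻¹ * (-x' / (2 * s t)) * (x t - y)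
        + (√(s t))⁻¹ * (s' / (4 * s t ^ 2)) * (x t - y) ^ 2)
        * Real.exp (-(x t - y) ^ 2 / (4 * s t))) t := by
  have hq : 0 < √(s t) := Real.sqrt_pos.2 hp
  have h1 := (hs.sqrt hp.ne').inv hq.ne'
  have h2 := ((((hx.sub_const y).pow 2).neg).div (hs.const_mul 4) (by positivity)).exp
  refine (h1.mul h2).congr_deriv ?_
  simp only [Pi.inv_apply, Pi.neg_apply, Pi.pow_apply, Pi.div_apply]
  have hsq : s t = √(s t) ^ 2 := (Real.sq_sqrt hp.le).symm
  set q := √(s t)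
  rw [hsq]
  field_simp
  ring

lemma aux_Hcurve {φ : ℝ → ℝ} (hφc : Continuous φ) {Bd : ℝ} (hφb : ∀ y, |φ y| ≤ Bd)
    {s x s' x' : ℝ → ℝ} {t0 : ℝ} (hs : ∀ t, HasDerivAt s (s' t) t)
    (hx : ∀ t, HasDerivAt x (x' t) t) (hs' : ContinuousAt s' t0) (hx' : ContinuousAt x' t0)
    (hp : 0 < s t0) :
    HasDerivAt (fun t => auxH φ (s t) (x t))
      (∫ y, φ y * (((√(s t0))⁻¹ * (-s' t0 / (2 * s t0))
        + (√(s t0))⁻¹ * (-x' t0 / (2 * s t0)) * (x t0 - y)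
        + (√(s t0))⁻¹ * (s' t0 / (4 * s t0 ^ 2)) * (x t0 - y) ^ 2)
        * Real.exp (-(x t0 - y) ^ 2 / (4 * s t0)))) t0 := by
  have hsc : ContinuousAt s t0 := (hs t0).continuousAt
  have hxc : ContinuousAt x t0 := (hx t0).continuousAt
  have hq : 0 < √(s t0) := Real.sqrt_pos.2 hp
  have hqi : ContinuousAt (fun t => (√(s t))⁻¹) t0 := (hsc.sqrt).inv₀ hq.ne'
  refine aux_dom hφc hφb (fun t y => (√(s t))⁻¹ * Real.exp (-(x t - y) ^ 2 / (4 * s t)))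
    (fun t => (√(s t))⁻¹ * (-s' t / (2 * s t))) (fun t => (√(s t))⁻¹ * (-x' t / (2 * s t)))
    (fun t => (√(s t))⁻¹ * (s' t / (4 * s t ^ 2))) x s t0 ?_ ?_ ?_ hxc hsc hp ?_ ?_ ?_
  · exact hqi.mul (hs'.neg.div (hsc.const_mul 2) (by positivity))
  · exact hqi.mul (hx'.neg.div (hsc.const_mul 2) (by positivity))
  · exact hqi.mul (hs'.div ((hsc.pow 2).const_mul 4) (by positivity))
  · intro t; fun_prop
  · have := aux_qint hφc hφb ((√(s t0))⁻¹) 0 0 (x t0) (s t0) hp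
    simpa using this
  · filter_upwards [continuousAt_const.eventually_lt hsc hp] with t ht y
    exact aux_kder y (hs t) (hx t) ht

lemma aux_H2 {φ : ℝ → ℝ} (hφc : Continuous φ) {Bd : ℝ} (hφb : ∀ y, |φ y| ≤ Bd)
    (s a k θ : ℝ) (hs : 0 < s) :
    HasDerivAt (fun t => ∫ y, φ y * ((0 + k * (a * t - y) + 0 * (a * t - y) ^ 2)
        * Real.exp (-(a * t - y) ^ 2 / (4 * s))))
      (∫ y, φ y * ((k * a + 0 * (a * θ - y) + (-(k * a) / (2 * s)) * (a * θ - y) ^ 2)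
        * Real.exp (-(a * θ - y) ^ 2 / (4 * s)))) θ := by
  refine aux_dom hφc hφb (fun t y => (0 + k * (a * t - y) + 0 * (a * t - y) ^ 2)
        * Real.exp (-(a * t - y) ^ 2 / (4 * s))) (fun _ => k * a) (fun _ => 0)
        (fun _ => -(k * a) / (2 * s)) (fun t => a * t) (fun _ => s) θ
        continuousAt_const continuousAt_const continuousAt_const (by fun_prop)
        continuousAt_const hs ?_ ?_ ?_
  · intro t; fun_prop
  · exact aux_qint hφc hφb 0 k 0 (a * θ) s hs
  · refine Eventually.of_forall fun t y => ?_
    have h0 : HasDerivAt (fun r => a * r - y) a t := by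
      simpa using! ((hasDerivAt_id t).const_mul a).sub_const y
    have h1 := (h0.const_mul k)
    have h2 := (((h0.pow 2).neg).div_const (4 * s)).exp
    have h3 := h1.mul h2
    refine (h3.congr_of_eventuallyEq (Eventually.of_forall fun r => ?_)).congr_deriv ?_
    · simp
    · simp only [Pi.neg_apply, Pi.pow_apply]
      field_simp
      ring

/-- the candidate solution -/
noncomputable def auxU (δ : ℝ) (φ : ℝ → ℝ) (σ θ : ℝ) : ℝ :=
  ∫ z, φ (Real.exp (-σ / 2) * θ + √(2 * δ * (1 - Real.exp (-σ))) * z)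
    ∂(ProbabilityTheory.gaussianReal 0 1)

lemma aux_map (x b : ℝ) : (ProbabilityTheory.gaussianReal 0 1).map (fun z => x + b * z)
    = ProbabilityTheory.gaussianReal x (b ^ 2).toNNReal := by
  have h1 := ProbabilityTheory.gaussianReal_map_const_mul (μ := 0) (v := 1) b
  have h2 := ProbabilityTheory.gaussianReal_map_const_add (μ := 0) (v := (b ^ 2).toNNReal) x
  have e : (NNReal.mk (b ^ 2) (sq_nonneg b) * 1 : NNReal) = (b ^ 2).toNNReal := by
    rw [mul_one]; ext; simp [Real.coe_toNNReal _ (sq_nonneg b)]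
  rw [e, mul_zero] at h1
  rw [← h1, Measure.map_map (by fun_prop) (by fun_prop), zero_add] at h2
  exact h2

lemma aux_U_eq {δ : ℝ} (hδ : 0 < δ) {φ : ℝ → ℝ} (hφc : Continuous φ) {σ : ℝ} (hσ : 0 < σ)
    (θ : ℝ) : auxU δ φ σ θ = (√(4 * Real.pi))⁻¹ *
      auxH φ (δ * (1 - Real.exp (-σ))) (Real.exp (-σ / 2) * θ) := by
  have hs : 0 < δ * (1 - Real.exp (-σ)) := by
    apply mul_pos hδ; have : Real.exp (-σ) < 1 := by simpa using hσ
    linarith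
  unfold auxU
  set x := Real.exp (-σ / 2) * θ
  set s := δ * (1 - Real.exp (-σ)) with hsd
  have e0 : 2 * δ * (1 - Real.exp (-σ)) = 2 * s := by rw [hsd]; ring
  rw [e0]
  have e1 := aux_map x (√(2 * s))
  rw [Real.sq_sqrt (by positivity)] at e1
  have e2 : ∫ z, φ (x + √(2 * s) * z) ∂(ProbabilityTheory.gaussianReal 0 1)
      = ∫ y, φ y ∂(ProbabilityTheory.gaussianReal x (2 * s).toNNReal) := by
    rw [← e1, integral_map (by fun_prop) hφc.aestronglyMeasurable]
  rw [e2, ProbabilityTheory.integral_gaussianReal_eq_integral_smul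
    (by simpa using hs)]
  unfold auxH
  rw [← integral_const_mul]
  congr 1
  ext y
  rw [ProbabilityTheory.gaussianPDFReal, Real.coe_toNNReal _ (by positivity)]
  have e3 : 2 * Real.pi * (2 * s) = (4 * Real.pi) * s := by ring
  rw [e3, Real.sqrt_mul (by positivity), mul_inv, smul_eq_mul]
  have e4 : -(y - x) ^ 2 / (2 * (2 * s)) = -(x - y) ^ 2 / (4 * s) := by ring
  rw [e4]; ring

lemma aux_U_pde {δ : ℝ} (hδ : 0 < δ) {φ : ℝ → ℝ} (hφc : Continuous φ) {Bd : ℝ}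
    (hφb : ∀ y, |φ y| ≤ Bd) : ∃ Ut U1 U2 : ℝ → ℝ → ℝ,
    (∀ s, 0 < s → ∀ x, HasDerivAt (fun r => auxU δ φ r x) (Ut s x) s) ∧
    (∀ s, 0 < s → ∀ x, HasDerivAt (auxU δ φ s) (U1 s x) x) ∧
    (∀ s, 0 < s → ∀ x, HasDerivAt (U1 s) (U2 s x) x) ∧
    (∀ s, 0 < s → ∀ x, Ut s x = δ * U2 s x - x / 2 * U1 s x) := by
  set S : ℝ → ℝ := fun σ => δ * (1 - Real.exp (-σ)) with hS
  set a : ℝ → ℝ := fun σ => Real.exp (-σ / 2) with ha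
  have hSp : ∀ σ, 0 < σ → 0 < S σ := fun σ hσ => by
    apply mul_pos hδ; have : Real.exp (-σ) < 1 := by simpa using hσ
    linarith
  have hS' : ∀ t, HasDerivAt S (δ * a t ^ 2) t := by
    intro t
    have := (((hasDerivAt_id t).neg.exp).const_sub 1).const_mul δ
    refine this.congr_deriv ?_
    have : a t ^ 2 = Real.exp (-t) := by
      rw [ha, ← Real.exp_nat_mul]; congr 1; push_cast; ring
    simp [this]
  have ha' : ∀ t, HasDerivAt a (-a t / 2) t := by
    intro t
    have := ((hasDerivAt_id t).neg.div_const 2).exp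
    refine this.congr_deriv ?_
    simp [ha]; ring
  have hac : Continuous a := by rw [ha]; fun_prop
  set c := (√(4 * Real.pi))⁻¹ with hc
  set K : ℝ → ℝ → ℝ → ℝ → ℝ → ℝ := fun A B C σ x => ∫ y, φ y *
    ((A + B * (a σ * x - y) + C * (a σ * x - y) ^ 2)
      * Real.exp (-(a σ * x - y) ^ 2 / (4 * S σ))) with hK
  refine ⟨fun σ x => c * K ((√(S σ))⁻¹ * (-(δ * a σ ^ 2) / (2 * S σ)))
      ((√(S σ))⁻¹ * (-(-a σ / 2 * x) / (2 * S σ)))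
      ((√(S σ))⁻¹ * (δ * a σ ^ 2 / (4 * S σ ^ 2))) σ x,
    fun σ x => c * K 0 ((√(S σ))⁻¹ * (-a σ / (2 * S σ))) 0 σ x,
    fun σ x => c * K ((√(S σ))⁻¹ * (-a σ / (2 * S σ)) * a σ) 0
      (-((√(S σ))⁻¹ * (-a σ / (2 * S σ)) * a σ) / (2 * S σ)) σ x, ?_, ?_, ?_, ?_⟩
  · intro σ hσ x
    have h := (aux_Hcurve hφc hφb (s := S) (x := fun t => a t * x) (s' := fun t => δ * a t ^ 2)
      (x' := fun t => -a t / 2 * x) (t0 := σ) hS' (fun t => (ha' t).mul_const x)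
      (by fun_prop) (by fun_prop) (hSp σ hσ)).const_mul c
    refine h.congr_of_eventuallyEq ?_
    filter_upwards [Ioi_mem_nhds hσ] with t ht
    exact aux_U_eq hδ hφc ht x
  · intro σ hσ x
    have h := (aux_Hcurve hφc hφb (s := fun _ => S σ) (x := fun t => a σ * t) (s' := fun t => 0)
      (x' := fun t => a σ) (t0 := x) (fun t => hasDerivAt_const _ _)
      (fun t => by simpa using! (hasDerivAt_id t).const_mul (a σ))
      (by fun_prop) (by fun_prop) (hSp σ hσ)).const_mul c
    refine (h.congr_of_eventuallyEq ?_).congr_deriv ?_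
    · exact Eventually.of_forall fun t => aux_U_eq hδ hφc hσ t
    · simp [hK]
  · intro σ hσ x
    exact (aux_H2 hφc hφb (S σ) (a σ) _ x (hSp σ hσ)).const_mul c
  · intro σ hσ x
    have hp := hSp σ hσ
    simp only [hK]
    have i1 := aux_qint hφc hφb 0 ((√(S σ))⁻¹ * (-a σ / (2 * S σ))) 0 (a σ * x) (S σ) hp
    have i2 := aux_qint hφc hφb ((√(S σ))⁻¹ * (-a σ / (2 * S σ)) * a σ) 0
      (-((√(S σ))⁻¹ * (-a σ / (2 * S σ)) * a σ) / (2 * S σ)) (a σ * x) (S σ) hp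
    clear_value S a
    rw [mul_left_comm δ, mul_left_comm (x / 2), ← mul_sub]
    congr 1
    rw [← integral_const_mul, ← integral_const_mul, ← integral_sub (i2.const_mul δ)
      (i1.const_mul _)]
    congr 1
    ext y
    field_simp
    ring

lemma aux_U_cont {δ : ℝ} {φ : ℝ → ℝ} (hφc : Continuous φ) {Bd : ℝ}
    (hφb : ∀ y, |φ y| ≤ Bd) : Continuous (Function.uncurry (auxU δ φ)) := by
  unfold Function.uncurry auxU
  refine continuous_of_dominated (bound := fun _ => Bd) (fun p => ?_) (fun p => ?_)
    (integrable_const _) ?_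
  · exact (by fun_prop : Continuous _).aestronglyMeasurable
  · exact Eventually.of_forall fun z => hφb _
  · refine Eventually.of_forall fun z => ?_
    fun_prop

lemma aux_U_bdd {δ : ℝ} {φ : ℝ → ℝ} {Bd : ℝ}
    (hφb : ∀ y, |φ y| ≤ Bd) (σ θ : ℝ) : |auxU δ φ σ θ| ≤ Bd := by
  have := norm_integral_le_of_norm_le_const (μ := ProbabilityTheory.gaussianReal 0 1)
    (f := fun z => φ (Real.exp (-σ / 2) * θ + √(2 * δ * (1 - Real.exp (-σ))) * z)) (C := Bd)
    (Eventually.of_forall fun z => hφb _)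
  simpa using! this

lemma aux_weight {d : ℝ} (hd : 0 < d) (θ : ℝ) :
    ProbabilityTheory.gaussianPDFReal 0 (2 * d).toNNReal θ = gaussWeight d θ := by
  rw [ProbabilityTheory.gaussianPDFReal, gaussWeight, Real.coe_toNNReal _ (by positivity),
    Real.rpow_neg (by positivity), ← Real.sqrt_eq_rpow]
  congr 3 <;> ring_nf

lemma aux_int_weight {d : ℝ} (hd : 0 < d) (g : ℝ → ℝ) :
    ∫ θ, g θ * gaussWeight d θ
      = ∫ θ, g θ ∂(ProbabilityTheory.gaussianReal 0 (2 * d).toNNReal) := by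
  rw [ProbabilityTheory.integral_gaussianReal_eq_integral_smul (by simpa using hd)]
  simp_rw [aux_weight hd, smul_eq_mul, mul_comm]

lemma aux_weight_int {d : ℝ} (hd : 0 < d) : Integrable (gaussWeight d) := by
  have := ProbabilityTheory.integrable_gaussianPDFReal 0 (2 * d).toNNReal
  exact this.congr (Eventually.of_forall fun θ => aux_weight hd θ)

lemma aux_weight_nonneg {d : ℝ} (hd : 0 < d) (θ : ℝ) : 0 ≤ gaussWeight d θ := by
  unfold gaussWeight; positivity

lemma aux_weight_le {δ μ lam : ℝ} (hδ : 0 < δ) (h1 : δ ≤ μ) (h2 : μ ≤ lam) (θ : ℝ) :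
    gaussWeight μ θ ≤ (lam / δ) ^ ((1:ℝ) / 2) * gaussWeight lam θ := by
  have hμ : 0 < μ := hδ.trans_le h1
  have hl : 0 < lam := hμ.trans_le h2
  unfold gaussWeight
  rw [← mul_assoc]
  have e : (lam / δ) ^ ((1:ℝ) / 2) * (4 * Real.pi * lam) ^ (-(1 / 2 : ℝ))
      = (4 * Real.pi * δ) ^ (-(1 / 2 : ℝ)) := by
    rw [Real.rpow_neg (by positivity), Real.rpow_neg (by positivity),
      ← Real.inv_rpow (by positivity), ← Real.inv_rpow (by positivity),
      ← Real.mul_rpow (by positivity) (by positivity)]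
    congr 1
    field_simp
  rw [e]
  gcongr ?_ * ?_
  · apply Real.rpow_le_rpow_of_nonpos (by positivity) (by gcongr) (by norm_num)
  · apply Real.exp_le_exp.2
    rw [neg_div, neg_div, neg_le_neg_iff]
    gcongr

lemma aux_compose {g : ℝ → ℝ} (hg : Continuous g) {C : ℝ} (hC : ∀ y, |g y| ≤ C)
    (a b : ℝ) (v : NNReal) :
    ∫ θ, ∫ z, g (a * θ + b * z) ∂(ProbabilityTheory.gaussianReal 0 1)
      ∂(ProbabilityTheory.gaussianReal 0 v)
    = ∫ y, g y ∂(ProbabilityTheory.gaussianReal 0 ((a ^ 2 * v + b ^ 2).toNNReal)) := by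
  have h1 := ProbabilityTheory.gaussianReal_map_const_mul (μ := 0) (v := v) a
  have h2 := aux_map 0 b
  have h3 := ProbabilityTheory.gaussianReal_conv_gaussianReal (m₁ := 0) (m₂ := 0)
    (v₁ := NNReal.mk (a ^ 2) (sq_nonneg a) * v) (v₂ := (b ^ 2).toNNReal)
  have e : (NNReal.mk (a ^ 2) (sq_nonneg a) * v + (b ^ 2).toNNReal : NNReal)
      = (a ^ 2 * v + b ^ 2).toNNReal := by
    ext
    rw [Real.coe_toNNReal _ (by positivity)]
    simp [Real.coe_toNNReal _ (sq_nonneg b)]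
  rw [e, add_zero] at h3
  rw [mul_zero] at h1
  rw [← h3, integral_conv, ← h1, integral_map (by fun_prop)]
  · congr 1
    ext θ
    rw [← h2, integral_map (by fun_prop) (by fun_prop)]
    simp
  · have : Continuous (fun x => ∫ y, g (x + y)
        ∂(ProbabilityTheory.gaussianReal 0 (b ^ 2).toNNReal)) := by
      refine continuous_of_dominated (bound := fun _ => C) (fun p => ?_) (fun p => ?_)
        (integrable_const _) ?_
      · exact (by fun_prop : Continuous _).aestronglyMeasurable
      · exact Eventually.of_forall fun z => hC _
      · exact Eventually.of_forall fun z => by fun_prop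
    exact this.aestronglyMeasurable
  · exact (integrable_const C).mono' hg.aestronglyMeasurable (Eventually.of_forall hC)

lemma aux_core {m δ lam : ℝ} (hm : 1 ≤ m) (hδ : 0 < δ) (hδlam : δ ≤ lam)
    {φ : ℝ → ℝ} (hφc : Continuous φ) {Bd : ℝ} (hφb : ∀ y, |φ y| ≤ Bd) {σ : ℝ} (hσ : 0 ≤ σ) :
    gaussNorm m lam (auxU δ φ σ) ≤ (lam / δ) ^ ((1:ℝ) / 2) * gaussNorm m lam φ := by
  have hm0 : 0 < m := by linarith
  have hl : 0 < lam := hδ.trans_le hδlam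
  have hBd : 0 ≤ Bd := (abs_nonneg _).trans (hφb 0)
  have hgen : ∀ f : ℝ → ℝ, Continuous f → Continuous (fun y => |f y| ^ m) :=
    fun f hf => hf.abs.rpow_const fun _ => Or.inr hm0.le
  have hgb : ∀ f : ℝ → ℝ, (∀ y, |f y| ≤ Bd) → ∀ y, |(|f y| ^ m)| ≤ Bd ^ m := by
    intro f hf y
    rw [abs_of_nonneg (by positivity)]
    exact Real.rpow_le_rpow (abs_nonneg _) (hf y) hm0.le
  set a := Real.exp (-σ / 2) with ha
  set b := √(2 * δ * (1 - Real.exp (-σ))) with hb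
  have hexp : Real.exp (-σ) ≤ 1 := by simpa using hσ
  have hb2 : b ^ 2 = 2 * δ * (1 - Real.exp (-σ)) := by
    rw [hb, Real.sq_sqrt]
    have : 0 ≤ 1 - Real.exp (-σ) := by linarith
    positivity
  have ha2 : a ^ 2 = Real.exp (-σ) := by
    rw [ha, ← Real.exp_nat_mul]; congr 1; push_cast; ring
  set μ := lam * Real.exp (-σ) + δ * (1 - Real.exp (-σ)) with hμ
  have hep : 0 < Real.exp (-σ) := Real.exp_pos _
  have hμ1 : δ ≤ μ := by rw [hμ]; nlinarith
  have hμ2 : μ ≤ lam := by rw [hμ]; nlinarith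
  have hμ0 : 0 < μ := hδ.trans_le hμ1
  have hUc : Continuous (auxU δ φ σ) := by
    have := aux_U_cont (δ := δ) hφc hφb
    exact this.comp (by fun_prop : Continuous fun x : ℝ => (σ, x))
  have jensen : ∀ θ, |auxU δ φ σ θ| ^ m
      ≤ ∫ z, |φ (a * θ + b * z)| ^ m ∂(ProbabilityTheory.gaussianReal 0 1) := by
    intro θ
    have hcc : Continuous (fun z => φ (a * θ + b * z)) := by fun_prop
    have t1 : |auxU δ φ σ θ| ≤ ∫ z, |φ (a * θ + b * z)| ∂(ProbabilityTheory.gaussianReal 0 1) :=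
      abs_integral_le_integral_abs
    refine (Real.rpow_le_rpow (abs_nonneg _) t1 hm0.le).trans ?_
    refine (convexOn_rpow hm).map_integral_le (f := fun z => |φ (a * θ + b * z)|)
      ?_ isClosed_Ici (Eventually.of_forall fun z => mem_Ici.2 (abs_nonneg _)) ?_ ?_
    · exact (Real.continuous_rpow_const hm0.le).continuousOn
    · refine (integrable_const Bd).mono' hcc.abs.aestronglyMeasurable
        (Eventually.of_forall fun z => ?_)
      simpa using hφb _
    · exact (integrable_const (Bd ^ m)).mono' (hgen _ hcc).aestronglyMeasurable
        (Eventually.of_forall fun z => hgb _ (fun z => hφb _) z)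
  have hint : ∫ θ, |auxU δ φ σ θ| ^ m * gaussWeight lam θ
      ≤ (lam / δ) ^ ((1:ℝ) / 2) * ∫ θ, |φ θ| ^ m * gaussWeight lam θ := by
    have hcomp := aux_compose (hgen φ hφc) (hgb φ hφb) a b (2 * lam).toNNReal
    have hv : a ^ 2 * ((2 * lam).toNNReal : ℝ) + b ^ 2 = 2 * μ := by
      rw [Real.coe_toNNReal _ (by positivity), ha2, hb2, hμ]; ring
    rw [hv, ← aux_int_weight hμ0] at hcomp
    calc _ = ∫ θ, |auxU δ φ σ θ| ^ m
          ∂(ProbabilityTheory.gaussianReal 0 (2 * lam).toNNReal) := aux_int_weight hl _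
      _ ≤ ∫ θ, ∫ z, |φ (a * θ + b * z)| ^ m ∂(ProbabilityTheory.gaussianReal 0 1)
          ∂(ProbabilityTheory.gaussianReal 0 (2 * lam).toNNReal) := by
        refine integral_mono ?_ ?_ jensen
        · exact (integrable_const (Bd ^ m)).mono' (hgen _ hUc).aestronglyMeasurable
            (Eventually.of_forall fun z => hgb _ (fun z => aux_U_bdd hφb _ _) z)
        · have hcont : Continuous (fun θ => ∫ z, |φ (a * θ + b * z)| ^ m
              ∂(ProbabilityTheory.gaussianReal 0 1)) := by
            refine continuous_of_dominated (bound := fun _ => Bd ^ m) (fun p => ?_) (fun p => ?_)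
              (integrable_const _) ?_
            · exact (hgen (fun z => φ (a * p + b * z)) (by fun_prop)).aestronglyMeasurable
            · exact Eventually.of_forall fun z => hgb φ hφb _
            · exact Eventually.of_forall fun z => hgen (fun p => φ (a * p + b * z)) (by fun_prop)
          refine (integrable_const (Bd ^ m)).mono' hcont.aestronglyMeasurable
            (Eventually.of_forall fun θ => ?_)
          have := norm_integral_le_of_norm_le_const (μ := ProbabilityTheory.gaussianReal 0 1)
            (f := fun z => |φ (a * θ + b * z)| ^ m) (C := Bd ^ m)
            (Eventually.of_forall fun z => hgb φ hφb _)
          simpa using this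
      _ = ∫ θ, |φ θ| ^ m * gaussWeight μ θ := hcomp
      _ ≤ ∫ θ, (lam / δ) ^ ((1:ℝ) / 2) * (|φ θ| ^ m * gaussWeight lam θ) := by
        refine integral_mono ?_ ?_ (fun θ => ?_)
        · exact (aux_weight_int hμ0).bdd_mul (hgen φ hφc).aestronglyMeasurable
            (Eventually.of_forall (hgb φ hφb))
        · exact ((aux_weight_int hl).bdd_mul (hgen φ hφc).aestronglyMeasurable
            (Eventually.of_forall (hgb φ hφb))).const_mul _
        · have := aux_weight_le hδ hμ1 hμ2 θ
          have h2 : 0 ≤ |φ θ| ^ m := by positivity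
          calc _ ≤ |φ θ| ^ m * ((lam / δ) ^ ((1:ℝ) / 2) * gaussWeight lam θ) :=
                mul_le_mul_of_nonneg_left this h2
            _ = _ := by ring
      _ = _ := integral_const_mul _ _
  have hn : ∀ f : ℝ → ℝ, 0 ≤ ∫ θ, |f θ| ^ m * gaussWeight lam θ := fun f =>
    integral_nonneg fun θ => mul_nonneg (by positivity) (aux_weight_nonneg hl θ)
  have hc1 : 1 ≤ (lam / δ) ^ ((1:ℝ) / 2) :=
    Real.one_le_rpow ((one_le_div hδ).2 hδlam) (by norm_num)
  unfold gaussNorm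
  refine (Real.rpow_le_rpow (hn _) hint (by positivity)).trans ?_
  rw [Real.mul_rpow (by positivity) (hn _)]
  gcongr
  · exact Real.rpow_nonneg (hn _) _
  · calc _ ≤ ((lam / δ) ^ ((1:ℝ) / 2)) ^ (1:ℝ) :=
          Real.rpow_le_rpow_of_exponent_le hc1 ((div_le_one hm0).2 hm)
      _ = _ := Real.rpow_one _

/-- Contraction properties of the rescaled Ornstein–Uhlenbeck-type semigroup
`T_δ(σ)φ = w(σ,·)`, where `w` is the bounded classical solution of
`w_σ = δ w_θθ - (θ/2) w_θ`, `w(0,·) = φ`, in Gaussian-weighted `L^m` spaces: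
(a) `‖T_δ(σ)φ‖_{L^m_{K_δ}} ≤ ‖φ‖_{L^m_{K_δ}}`, and
(b) for `0 < δ ≤ λ`, `‖T_δ(σ)φ‖_{L^m_{K_λ}} ≤ (λ/δ)^{1/2} ‖φ‖_{L^m_{K_λ}}`. -/
theorem semigroup_gaussian_contraction
    (m δ lam : ℝ) (hm : 1 ≤ m) (hδ : 0 < δ) (hδlam : δ ≤ lam)
    (φ : ℝ → ℝ) (hφc : Continuous φ) (hφb : ∃ B : ℝ, ∀ θ : ℝ, |φ θ| ≤ B)
    (w : ℝ → ℝ → ℝ)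
    (hw_cont : ContinuousOn (Function.uncurry w) (Ici (0:ℝ) ×ˢ (univ : Set ℝ)))
    (hw_bdd : ∃ B : ℝ, ∀ σ ∈ Ici (0:ℝ), ∀ θ : ℝ, |w σ θ| ≤ B)
    (hw_regx : ∀ σ ∈ Ioi (0:ℝ), ContDiff ℝ 2 (w σ))
    (hw_regt : ∀ θ : ℝ, ∀ σ ∈ Ioi (0:ℝ), DifferentiableAt ℝ (fun s => w s θ) σ)
    (hw0 : w 0 = φ)
    (hw_pde : ∀ σ ∈ Ioi (0:ℝ), ∀ θ : ℝ,
      deriv (fun s => w s θ) σ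
        = δ * deriv (deriv (w σ)) θ - θ / 2 * deriv (w σ) θ)
    (σ : ℝ) (hσ : 0 ≤ σ) :
    gaussNorm m δ (w σ) ≤ gaussNorm m δ φ ∧
    gaussNorm m lam (w σ) ≤ (lam / δ) ^ ((1:ℝ) / 2) * gaussNorm m lam φ := by
  obtain ⟨Bd, hφb⟩ := hφb
  obtain ⟨Bw, hwb⟩ := hw_bdd
  obtain ⟨Ut, U1, U2, hUt, hU1, hU2, hUp⟩ := aux_U_pde hδ hφc hφb
  have hUc := (aux_U_cont (δ := δ) hφc hφb).continuousOn (s := Ici (0:ℝ) ×ˢ (univ : Set ℝ))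
  have hU0 : ∀ x, auxU δ φ 0 x = φ x := fun x => by simp [auxU]
  have hUb := aux_U_bdd (δ := δ) hφb
  have dt : ∀ s, 0 < s → ∀ x, HasDerivAt (fun r => w r x) (deriv (fun r => w r x) s) s :=
    fun s hs x => (hw_regt x s hs).hasDerivAt
  have d1 : ∀ s, 0 < s → ∀ x, HasDerivAt (w s) (deriv (w s) x) x :=
    fun s hs x => ((hw_regx s hs).differentiable (by norm_num) x).hasDerivAt
  have d2 : ∀ s, 0 < s → ∀ x, HasDerivAt (deriv (w s)) (deriv (deriv (w s)) x) x := by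
    intro s hs x
    have h : ContDiff ℝ (1 + 1) (w s) := by
      have := hw_regx s hs
      norm_num; exact this
    have h' := (contDiff_succ_iff_deriv.1 h).2.2
    exact (h'.differentiable (by norm_num) x).hasDerivAt
  have le1 : ∀ s, 0 ≤ s → ∀ x, w s x - auxU δ φ s x ≤ 0 :=
    aux_maxprin δ hδ (fun s x => w s x - auxU δ φ s x) _ _ _ (Bw + Bd)
      (hw_cont.sub hUc)
      (fun s hs x => by have := (abs_le.1 (hwb s hs x)).2; have := (abs_le.1 (hUb s x)).1; linarith)
      (fun x => by simp [hU0, hw0])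
      (fun s hs x => (dt s hs x).sub (hUt s hs x))
      (fun s hs x => (d1 s hs x).sub (hU1 s hs x))
      (fun s hs x => (d2 s hs x).sub (hU2 s hs x))
      (fun s hs x => by
        rw [hw_pde s hs x, hUp s hs x]; ring)
  have le2 : ∀ s, 0 ≤ s → ∀ x, auxU δ φ s x - w s x ≤ 0 :=
    aux_maxprin δ hδ (fun s x => auxU δ φ s x - w s x) _ _ _ (Bw + Bd)
      (hUc.sub hw_cont)
      (fun s hs x => by have := (abs_le.1 (hwb s hs x)).1; have := (abs_le.1 (hUb s x)).2; linarith)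
      (fun x => by simp [hU0, hw0])
      (fun s hs x => (hUt s hs x).sub (dt s hs x))
      (fun s hs x => (hU1 s hs x).sub (d1 s hs x))
      (fun s hs x => (hU2 s hs x).sub (d2 s hs x))
      (fun s hs x => by
        rw [hw_pde s hs x, hUp s hs x]; ring)
  have hwU : w σ = auxU δ φ σ := by
    ext x; linarith [le1 σ hσ x, le2 σ hσ x]
  rw [hwU]
  refine ⟨?_, aux_core hm hδ hδlam hφc hφb hσ⟩
  have := aux_core hm hδ (le_refl δ) hφc hφb hσ
  rwa [div_self hδ.ne', Real.one_rpow, one_mul] at this
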